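/- Let n ≥ 1 be such that 2ⁿ ≥ 64n, and set N = 2ⁿ. Let (g_x)_{x ∈ Fin N} and (h_x)_{x ∈ Fin N} be 2N independent standard Gaussian random variables, set G = Σ_x g_x², H = Σ_x h_x², and define the random probability vector p on Fin N by p(x) = (g_x² + h_x²)/(G + H). Then Pr[Σ_{x ∈ Fin N} p(x)² ≤ 50 · 2^{−n/2}] ≥ 1 − 2^{−n/2}. -/

import Mathlib

open MeasureTheory ProbabilityTheory Real

lemma gauss_pow_integrable (k : ℕ) : Integrable (fun x : ℝ => x ^ k) (gaussianReal 0 1) := by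
  have := (memLp_id_gaussianReal (μ := 0) (v := 1) (k : NNReal)).integrable_norm_pow'
  refine (integrable_norm_iff (by fun_prop)).1 ?_
  simpa using this

lemma gauss_sq : ∫ x, x ^ 2 ∂(gaussianReal 0 1) = 1 := by
  have h := variance_fun_id_gaussianReal (μ := 0) (v := 1)
  rw [variance_eq_integral measurable_id'.aemeasurable] at h
  simpa using h

lemma gauss_four : ∫ x, x ^ 4 ∂(gaussianReal 0 1) = 3 := by
  have h : ∫ x, x ^ 4 ∂(gaussianReal 0 1)
      = iteratedDeriv 4 (mgf (fun x ↦ x) (gaussianReal 0 1)) 0 := by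
    rw [iteratedDeriv_mgf_zero] <;> simp
  rw [h, mgf_fun_id_gaussianReal]
  have e0 : ∀ t : ℝ, HasDerivAt (fun t : ℝ => rexp (t ^ 2 / 2)) (t * rexp (t ^ 2 / 2)) t := by
    intro t
    have := (((hasDerivAt_id t).pow 2).div_const 2).exp
    refine this.congr_deriv ?_
    simp only [Pi.pow_apply, id, Nat.cast_ofNat]
    ring
  have key : ∀ (p p' : ℝ → ℝ), (∀ t, HasDerivAt p (p' t) t) →
      deriv (fun t => p t * rexp (t ^ 2 / 2)) = fun t => (p' t + t * p t) * rexp (t ^ 2 / 2) := by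
    intro p p' hp
    ext t
    refine ((hp t).mul (e0 t)).deriv.trans ?_
    ring
  have d1 : deriv (fun t : ℝ => rexp (t ^ 2 / 2)) = fun t => t * rexp (t ^ 2 / 2) := by
    ext t; exact (e0 t).deriv
  have d2 := key (fun t => t) (fun _ => 1) (fun t => hasDerivAt_id t)
  have d3 := key (fun t => 1 + t * t) (fun t => 2 * t) (fun t => by
    refine (((hasDerivAt_id t).mul (hasDerivAt_id t)).const_add 1).congr_deriv ?_
    simp only [id]
    ring)
  have d4 := key (fun t => 2 * t + t * (1 + t * t)) (fun t => 3 + 3 * t ^ 2) (fun t => by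
    have := ((hasDerivAt_id t).const_mul 2).add ((hasDerivAt_id t).mul (((hasDerivAt_id t).mul (hasDerivAt_id t)).const_add 1))
    refine this.congr_deriv ?_
    simp only [id, Pi.mul_apply]
    ring)
  have hf : (fun t : ℝ => rexp (0 * t + ((1 : NNReal) : ℝ) * t ^ 2 / 2)) = fun t => rexp (t ^ 2 / 2) := by
    ext t; simp
  rw [hf, iteratedDeriv_succ', iteratedDeriv_succ', iteratedDeriv_succ', iteratedDeriv_one,
    d1, d2, d3, d4]
  simp

lemma gauss_memLp : MemLp (fun x : ℝ => x ^ 2) 2 (gaussianReal 0 1) := by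
  rw [memLp_two_iff_integrable_sq (by fun_prop)]
  simpa [← pow_mul] using gauss_pow_integrable 4

lemma gauss_var : Var[fun x : ℝ => x ^ 2; gaussianReal 0 1] = 2 := by
  rw [variance_eq_sub gauss_memLp]
  have : ((fun x : ℝ => x ^ 2) ^ 2) = fun x => x ^ 4 := by ext x; simp [← pow_mul]
  rw [this, gauss_sq, gauss_four]; norm_num

lemma pi_int (N k : ℕ) : Integrable (fun ω : Fin N → ℝ => ∑ x, ω x ^ k)
    (Measure.pi fun _ : Fin N => gaussianReal 0 1) :=
  integrable_finsetSum _ fun i _ =>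
    integrable_comp_eval (μ := fun _ : Fin N => gaussianReal 0 1) (i := i) (gauss_pow_integrable k)

lemma pi_integral (N k : ℕ) : ∫ ω, (∑ x, ω x ^ k) ∂(Measure.pi fun _ : Fin N => gaussianReal 0 1)
    = N * ∫ x, x ^ k ∂(gaussianReal 0 1) := by
  rw [integral_finsetSum]
  · have : ∀ i : Fin N, ∫ ω, (ω i) ^ k ∂(Measure.pi fun _ : Fin N => gaussianReal 0 1)
        = ∫ x, x ^ k ∂(gaussianReal 0 1) := fun i =>
      integral_comp_eval (μ := fun _ : Fin N => gaussianReal 0 1) (i := i)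
        (f := fun x : ℝ => x ^ k) (by fun_prop)
    simp [this]
  · exact fun i _ =>
      integrable_comp_eval (μ := fun _ : Fin N => gaussianReal 0 1) (i := i) (gauss_pow_integrable k)

lemma pi_memLp (N : ℕ) : MemLp (fun ω : Fin N → ℝ => ∑ x, ω x ^ 2) 2
    (Measure.pi fun _ : Fin N => gaussianReal 0 1) :=
  memLp_finsetSum _ fun i _ => gauss_memLp.comp_measurePreserving
    (measurePreserving_eval (fun _ : Fin N => gaussianReal 0 1) i)

lemma pi_var (N : ℕ) : Var[fun ω : Fin N → ℝ => ∑ x, ω x ^ 2;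
    Measure.pi fun _ : Fin N => gaussianReal 0 1] = 2 * N := by
  have h := variance_sum_pi (μ := fun _ : Fin N => gaussianReal 0 1)
    (X := fun _ x => x ^ 2) (fun _ => gauss_memLp)
  have e : (∑ i, fun ω : Fin N → ℝ => ω i ^ 2) = fun ω : Fin N → ℝ => ∑ x, ω x ^ 2 := by
    ext ω; simp
  rw [e] at h
  rw [h, gauss_var]; simp; ring

lemma prod_integral (N k : ℕ) :
    ∫ ω, ((∑ x, ω.1 x ^ k) + ∑ x, ω.2 x ^ k) ∂((Measure.pi fun _ : Fin N => gaussianReal 0 1).prod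
        (Measure.pi fun _ : Fin N => gaussianReal 0 1))
    = 2 * N * ∫ x, x ^ k ∂(gaussianReal 0 1) := by
  rw [integral_add ((pi_int N k).comp_fst _) ((pi_int N k).comp_snd _),
    integral_fun_fst (fun ω : Fin N → ℝ => ∑ x, ω x ^ k),
    integral_fun_snd (fun ω : Fin N → ℝ => ∑ x, ω x ^ k), pi_integral]
  simp; ring

/-- For `n ≥ 1` with `2ⁿ ≥ 64n`, `N = 2ⁿ`, and `2N` i.i.d. standard Gaussians `(g_x)`, `(h_x)`
with `G = Σ_x g_x²`, `H = Σ_x h_x²`, the random probability vector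
`p(x) = (g_x² + h_x²)/(G + H)` satisfies
`Pr[Σ_x p(x)² ≤ 50 · 2^{−n/2}] ≥ 1 − 2^{−n/2}`. -/
theorem collision_prob_haar_whp (n N : ℕ) (hn : 1 ≤ n) (hN : N = 2 ^ n)
    (h64 : 64 * n ≤ 2 ^ n) :
    ((Measure.pi fun _ : Fin N => gaussianReal 0 1).prod
        (Measure.pi fun _ : Fin N => gaussianReal 0 1))
      {ω | ∑ x : Fin N,
          (((ω.1 x) ^ 2 + (ω.2 x) ^ 2) /
            ((∑ y : Fin N, (ω.1 y) ^ 2) + ∑ y : Fin N, (ω.2 y) ^ 2)) ^ 2 ≤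
          50 * (2 : ℝ) ^ (-(n : ℝ) / 2)} ≥
      ENNReal.ofReal (1 - (2 : ℝ) ^ (-(n : ℝ) / 2)) := by
  classical
  set P := ((Measure.pi fun _ : Fin N => gaussianReal 0 1).prod
        (Measure.pi fun _ : Fin N => gaussianReal 0 1)) with hP
  set r : ℝ := (2 : ℝ) ^ (-(n : ℝ) / 2) with hr
  have hr0 : 0 < r := by positivity
  have hrN : r ^ 2 * N = 1 := by
    rw [hr, hN, ← Real.rpow_natCast, ← Real.rpow_mul (by norm_num)]
    push_cast
    rw [← Real.rpow_natCast, ← Real.rpow_add (by norm_num)]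
    have : -(n : ℝ) / 2 * 2 + n = 0 := by ring
    rw [this, Real.rpow_zero]
  have hN0 : (64 : ℝ) ≤ N := by
    have : 64 ≤ N := by omega
    exact_mod_cast this
  have hr8 : r ≤ 1 / 8 := by
    by_contra hc
    push Not at hc
    nlinarith
  set T : (Fin N → ℝ) × (Fin N → ℝ) → ℝ := fun ω => (∑ y, (ω.1 y) ^ 2) + ∑ y, (ω.2 y) ^ 2 with hT
  set Q : (Fin N → ℝ) × (Fin N → ℝ) → ℝ := fun ω => (∑ y, (ω.1 y) ^ 4) + ∑ y, (ω.2 y) ^ 4 with hQ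
  have hTm : MemLp T 2 P := ((pi_memLp N).comp_fst _).add ((pi_memLp N).comp_snd _)
  have hTi : ∫ ω, T ω ∂P = 2 * (N : ℝ) := by
    rw [hT, hP, prod_integral, gauss_sq, mul_one]
  have hTv : Var[T; P] = 4 * N := by
    rw [hT, hP, variance_add_prod (pi_memLp N) (pi_memLp N), pi_var]; ring
  have hQint : Integrable Q P := ((pi_int N 4).comp_fst _).add ((pi_int N 4).comp_snd _)
  have hQi : ∫ ω, Q ω ∂P = 6 * N := by
    rw [hQ, hP, prod_integral, gauss_four]; ring
  have hA := meas_ge_le_variance_div_sq hTm (c := N) (by linarith)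
  rw [hTi, hTv] at hA
  have hB := mul_meas_ge_le_integral_of_nonneg (μ := P) (f := Q)
    (Filter.Eventually.of_forall fun ω => by simp only [hQ, Pi.zero_apply]; positivity) hQint
    (25 * N ^ 2 * r)
  rw [hQi] at hB
  have hNr : (N : ℝ) * r * r = 1 := by linarith
  have hNpos : (0 : ℝ) < N := by linarith
  have hB' : P {ω | 25 * (N : ℝ) ^ 2 * r ≤ Q ω} ≤ ENNReal.ofReal (r / 4) := by
    rw [← ofReal_measureReal]
    apply ENNReal.ofReal_le_ofReal
    set b := P.real {ω | 25 * (N : ℝ) ^ 2 * r ≤ Q ω}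
    have h1 : (25 * (N : ℝ) ^ 2 * r * b) * r ≤ 6 * N * r := mul_le_mul_of_nonneg_right hB hr0.le
    have h2 : (25 * (N : ℝ) ^ 2 * r * b) * r = N * (25 * b) := by
      calc _ = N * (25 * b) * (N * r * r) := by ring
        _ = _ := by rw [hNr, mul_one]
    have h3 : (N : ℝ) * (25 * b) ≤ N * (6 * r) := by linarith
    have h4 := le_of_mul_le_mul_left h3 hNpos
    linarith
  have hA' : P {ω | (N : ℝ) ≤ |T ω - 2 * N|} ≤ ENNReal.ofReal (r / 2) := by
    refine hA.trans (ENNReal.ofReal_le_ofReal ?_)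
    have : 4 * (N : ℝ) / N ^ 2 = 4 * r ^ 2 := by
      field_simp
      linarith
    rw [this]
    nlinarith
  rw [ge_iff_le, ENNReal.ofReal_sub _ hr0.le, ENNReal.ofReal_one, tsub_le_iff_right]
  have hAB : P {ω | (N : ℝ) ≤ |T ω - 2 * N|} + P {ω | 25 * (N : ℝ) ^ 2 * r ≤ Q ω}
      ≤ ENNReal.ofReal r := by
    refine (add_le_add hA' hB').trans ?_
    rw [← ENNReal.ofReal_add (by positivity) (by positivity)]
    apply ENNReal.ofReal_le_ofReal
    linarith
  refine le_trans ?_ (add_le_add le_rfl hAB)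
  have hu : P Set.univ = 1 := measure_univ
  rw [← hu]
  refine le_trans (measure_mono ?_) ((measure_union_le _ _).trans
    (add_le_add le_rfl (measure_union_le _ _)))
  intro ω _
  by_cases hωA : (N : ℝ) ≤ |T ω - 2 * N|
  · exact Or.inr (Or.inl hωA)
  by_cases hωB : 25 * (N : ℝ) ^ 2 * r ≤ Q ω
  · exact Or.inr (Or.inr hωB)
  left
  push Not at hωA hωB
  have hTN : (N : ℝ) ≤ T ω := by
    have := (abs_lt.1 hωA).1
    linarith
  change ∑ x : Fin N, (((ω.1 x) ^ 2 + (ω.2 x) ^ 2) / T ω) ^ 2 ≤ 50 * r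
  simp_rw [div_pow]
  rw [← Finset.sum_div, div_le_iff₀ (pow_pos (by linarith) 2)]
  have h1 : ∑ x : Fin N, ((ω.1 x) ^ 2 + (ω.2 x) ^ 2) ^ 2 ≤ 2 * Q ω := by
    rw [hQ]
    simp only
    rw [← Finset.sum_add_distrib, Finset.mul_sum]
    refine Finset.sum_le_sum fun x _ => ?_
    nlinarith [sq_nonneg ((ω.1 x) ^ 2 - (ω.2 x) ^ 2)]
  have h2 : (N : ℝ) ^ 2 ≤ T ω ^ 2 := by gcongr
  have h3 : 50 * r * (N : ℝ) ^ 2 ≤ 50 * r * T ω ^ 2 := by gcongr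
  linarith
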